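/- arXiv:2103.09018 — 2 statements merged into one kernel-verified Lean document; each statement's English description precedes it below -/
import Mathlib

section
/- Let α ∈ (0,1) be irrational, T the rotation of angle α viewed as a 2-interval exchange transformation on [0,1) with discontinuity 1 − α, N ≥ 2 an integer, and T_f the Veech 1969 type extension of T with single marked point ζ₁ and integers a₁, a₂. If ζ₁ = 1 − mα for an integer m ≥ 1 with 0 < 1 − mα < 1, then T_f is minimal if and only if gcd(N, a₁, m·a₂) = 1. -/
open Set

noncomputable section

/-- The rotation of angle `α` on `[0,1)`: `x ↦ x + α mod 1`. -/
def rot (α : ℝ) (x : ℝ) : ℝ := Int.fract (x + α)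

/-- The skew product `T_f(x,s) = (Tx, s + f(x))` on `[0,1) × ℤ/Nℤ`. -/
def skew {N : ℕ} (T : ℝ → ℝ) (f : ℝ → ZMod N) : ℝ × ZMod N → ℝ × ZMod N :=
  fun p => (T p.1, p.2 + f p.1)

/-- Minimality of the skew product on `[0,1) × ℤ/Nℤ`, where `[0,1)` carries the topology of
the circle `ℝ/ℤ` (distances being measured in `AddCircle 1`) and `ℤ/Nℤ` is discrete:
every forward orbit is dense. -/
def MinimalExt {N : ℕ} (T : ℝ → ℝ) (f : ℝ → ZMod N) : Prop :=
  ∀ x ∈ Ico (0:ℝ) 1, ∀ s : ZMod N, ∀ y ∈ Ico (0:ℝ) 1, ∀ u : ZMod N, ∀ ε > 0, ∃ n : ℕ,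
    dist (((skew T f)^[n] (x, s)).1 : AddCircle (1:ℝ)) (y : AddCircle (1:ℝ)) < ε ∧
    ((skew T f)^[n] (x, s)).2 = u


/-- The two-valued step function: `a₁` on `[0,ζ)` and `a₂` on `[ζ,1)` (values in `ℤ/Nℤ`). -/
def twoval (N : ℕ) (ζ : ℝ) (a₁ a₂ : ℤ) (x : ℝ) : ZMod N :=
  if x < ζ then (a₁ : ZMod N) else (a₂ : ZMod N)

/-- The sum `⌊z⌋ + ⌊z + α⌋ + ⋯ + ⌊z + (m - 1)α⌋`, which serves as a transfer function
for the step cocycle with discontinuity `1 - mα`. -/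
def floorSum (α : ℝ) (m : ℕ) (z : ℝ) : ℤ :=
  ∑ k ∈ Finset.range m, ⌊z + k * α⌋

theorem floorSum_add_sub (α : ℝ) (m : ℕ) (z : ℝ) :
    floorSum α m (z + α) - floorSum α m z = ⌊z + m * α⌋ - ⌊z⌋ := by
  have h := Finset.sum_range_sub (fun k : ℕ => ⌊z + k * α⌋) m
  simp only [Nat.cast_zero, zero_mul, add_zero] at h
  rw [← h, Finset.sum_sub_distrib]
  unfold floorSum
  congr 1
  refine Finset.sum_congr rfl fun k _ => ?_
  congr 1
  push_cast
  ring

theorem floorSum_eq_add_fract (α : ℝ) (m : ℕ) (z : ℝ) :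
    floorSum α m z = m * ⌊z⌋ + floorSum α m (Int.fract z) := by
  have h : ∀ k : ℕ, ⌊z + k * α⌋ = ⌊z⌋ + ⌊Int.fract z + k * α⌋ := fun k => by
    rw [← Int.floor_intCast_add, ← add_assoc, Int.floor_add_fract]
  simp [floorSum, h, Finset.sum_add_distrib]

theorem floorSum_eq_zero {α : ℝ} (hα : 0 ≤ α) {m : ℕ} {z : ℝ} (hz : 0 ≤ z)
    (hzm : z + m * α < 1) : floorSum α m z = 0 := by
  refine Finset.sum_eq_zero fun k hk => Int.floor_eq_zero_iff.2 ⟨by positivity, ?_⟩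
  have : (k : ℝ) ≤ m := by exact_mod_cast (Finset.mem_range.1 hk).le
  nlinarith

/-- `floorSum` is locally constant on the right. -/
theorem exists_floorSum_eq_right (α : ℝ) (m : ℕ) (y : ℝ) :
    ∃ δ > 0, ∀ t ∈ Ico y (y + δ), floorSum α m t = floorSum α m y := by
  have h : ∀ᶠ t in nhds y, ∀ k ∈ Finset.range m, t + k * α < ⌊y + k * α⌋ + 1 := by
    refine (Filter.eventually_all_finset _).2 fun k _ => ?_
    have hc : Continuous fun t : ℝ => t + k * α := by fun_prop
    exact hc.continuousAt.eventually_lt_const (Int.lt_floor_add_one _)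
  obtain ⟨δ, hδ, hball⟩ := Metric.eventually_nhds_iff.1 h
  refine ⟨δ, hδ, fun t ht => Finset.sum_congr rfl fun k hk => Int.floor_eq_iff.2 ⟨?_, ?_⟩⟩
  · linarith [Int.floor_le (y + k * α), ht.1]
  · refine hball ?_ k hk
    rw [Real.dist_eq, abs_lt]
    constructor <;> linarith [ht.1, ht.2]

theorem twoval_fract {α ζ : ℝ} {m : ℕ} (hζ : ζ = 1 - m * α) (hζmem : ζ ∈ Ioo (0 : ℝ) 1)
    (N : ℕ) (a₁ a₂ : ℤ) (z : ℝ) :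
    twoval N ζ a₁ a₂ (Int.fract z) =
      ((a₁ + (a₂ - a₁) * (floorSum α m (z + α) - floorSum α m z) : ℤ) : ZMod N) := by
  have hz : ⌊z + m * α⌋ - ⌊z⌋ = ⌊Int.fract z + m * α⌋ := by
    rw [sub_eq_iff_eq_add', ← Int.floor_intCast_add, ← add_assoc, Int.floor_add_fract]
  rw [floorSum_add_sub, hz, twoval]
  have h0 := Int.fract_nonneg z
  have h1 := Int.fract_lt_one z
  obtain ⟨hζ0, hζ1⟩ := hζmem
  split_ifs with h
  · have : ⌊Int.fract z + m * α⌋ = 0 := Int.floor_eq_zero_iff.2 ⟨by linarith, by linarith⟩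
    simp [this]
  · have : ⌊Int.fract z + m * α⌋ = 1 :=
      Int.floor_eq_iff.2 ⟨by push_cast; linarith, by push_cast; linarith⟩
    simp [this]

/-- Closed form of the iterates of the skew product over the rotation. -/
theorem skew_rot_iterate {α ζ : ℝ} {m : ℕ} (hζ : ζ = 1 - m * α) (hζmem : ζ ∈ Ioo (0 : ℝ) 1)
    (N : ℕ) (a₁ a₂ : ℤ) {x : ℝ} (hx : x ∈ Ico (0 : ℝ) 1) (s : ZMod N) (n : ℕ) :
    (skew (rot α) (twoval N ζ a₁ a₂))^[n] (x, s) =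
      (Int.fract (x + n * α),
        s + ((n * a₁ + (a₂ - a₁) * (floorSum α m (x + n * α) - floorSum α m x) : ℤ) :
          ZMod N)) := by
  induction n with
  | zero => simp [Int.fract_eq_self.2 hx]
  | succ n ih =>
    have hstep : x + ((n + 1 : ℕ) : ℝ) * α = x + n * α + α := by push_cast; ring
    rw [Function.iterate_succ_apply', ih, hstep]
    refine Prod.ext ?_ ?_
    · change Int.fract (Int.fract (x + n * α) + α) = _
      rw [Int.fract_eq_fract]
      exact ⟨-⌊x + n * α⌋, by rw [Int.fract]; push_cast; ring⟩
    · change _ + twoval N ζ a₁ a₂ (Int.fract (x + n * α)) = _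
      rw [twoval_fract hζ hζmem]
      push_cast
      ring

/-- Forward orbits of an irrational rotation are dense, in terms of real lifts. -/
theorem exists_add_nat_mul_sub_int_mem_Ioo {α : ℝ} (hirr : Irrational α) (w : ℝ) {a b : ℝ}
    (hab : a < b) : ∃ (k : ℕ) (q : ℤ), w + k * α - q ∈ Ioo a b := by
  have hd : DenseRange (fun k : ℕ => k • (α : AddCircle (1 : ℝ))) := by
    rw [← denseRange_zsmul_iff_nsmul, AddCircle.denseRange_zsmul_coe_iff, div_one]
    exact hirr
  have ho : IsOpen ((fun t : ℝ => (t : AddCircle (1 : ℝ))) '' Ioo (a - w) (b - w)) :=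
    QuotientAddGroup.isOpenMap_coe _ isOpen_Ioo
  obtain ⟨k, t, ht, hk⟩ := hd.exists_mem_open ho
    ((nonempty_Ioo.2 (by linarith : a - w < b - w)).image _)
  have hk' : ((k * α - t : ℝ) : AddCircle (1 : ℝ)) = 0 := by
    rw [AddCircle.coe_sub, ← nsmul_eq_mul, AddCircle.coe_nsmul, sub_eq_zero]
    exact hk.symm
  obtain ⟨q, hq⟩ := (AddCircle.coe_eq_zero_iff (1 : ℝ)).1 hk'
  rw [zsmul_one] at hq
  exact ⟨k, q, by linarith [ht.1], by linarith [ht.2]⟩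

/-- Simultaneous control of the return time and of the winding number modulo `N`. -/
theorem exists_fract_mem_Ioo_of_modEq {α : ℝ} (hirr : Irrational α) {N : ℕ} (hN : 0 < N)
    (x : ℝ) (r q : ℤ) {a b : ℝ} (ha : 0 ≤ a) (hab : a < b) (hb : b ≤ 1) :
    ∃ n : ℕ, (n : ℤ) ≡ r [ZMOD N] ∧ ⌊x + n * α⌋ ≡ q [ZMOD N] ∧
      Int.fract (x + n * α) ∈ Ioo a b := by
  have hN' : (0 : ℝ) < N := by exact_mod_cast hN
  obtain ⟨r', hr'⟩ := Int.eq_ofNat_of_zero_le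
    (Int.emod_nonneg r (by exact_mod_cast hN.ne' : (N : ℤ) ≠ 0))
  obtain ⟨k, p, h⟩ := exists_add_nat_mul_sub_int_mem_Ioo hirr ((x + r' * α) / N)
    (div_lt_div_of_pos_right (by linarith : q + a < q + b) hN')
  have hmul : ((x + r' * α) / N + k * α - p) * N = x + (r' + N * k : ℕ) * α - N * p := by
    push_cast
    field_simp
    ring
  have hl := (div_lt_iff₀ hN').1 h.1
  have hu := (lt_div_iff₀ hN').1 h.2
  rw [hmul] at hl hu
  have hfl : ⌊x + (r' + N * k : ℕ) * α⌋ = q + N * p :=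
    Int.floor_eq_iff.2 ⟨by push_cast at *; linarith, by push_cast at *; linarith⟩
  refine ⟨r' + N * k, ?_, ?_, ?_⟩
  · push_cast
    rw [← hr']
    simp [Int.ModEq]
  · rw [hfl]
    simp [Int.ModEq]
  · rw [Int.fract, hfl]
    constructor <;> push_cast at * <;> linarith

theorem dist_coe_addCircle_le (t y : ℝ) :
    dist (t : AddCircle (1 : ℝ)) (y : AddCircle (1 : ℝ)) ≤ |t - y| := by
  rw [dist_eq_norm, ← AddCircle.coe_sub, UnitAddCircle.norm_eq]
  simpa using round_le (t - y) 0

theorem mem_Ioo_of_dist_coe_addCircle_lt {t y : ℝ} (ht : t ∈ Ico (0 : ℝ) 1)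
    (hy : 2 * y < 1)
    (h : dist (t : AddCircle (1 : ℝ)) (y : AddCircle (1 : ℝ)) < y) : t ∈ Ioo 0 (2 * y) := by
  rw [dist_eq_norm, ← AddCircle.coe_sub, UnitAddCircle.norm_eq, abs_lt] at h
  obtain ⟨h1, h2⟩ := h
  obtain ⟨ht0, ht1⟩ := ht
  have hr1 : round (t - y) < 1 := by
    have : (round (t - y) : ℝ) < 1 := by linarith
    exact_mod_cast this
  have hr2 : -1 < round (t - y) := by
    have : (-1 : ℝ) < round (t - y) := by linarith
    exact_mod_cast this
  have hr : round (t - y) = 0 := by omega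
  rw [hr] at h1 h2
  push_cast at h1 h2
  exact ⟨by linarith, by linarith⟩

/-- If `N`, `a` and `b` have no common factor, every residue modulo `N` is a combination
of `a` and `b`. -/
theorem exists_mul_add_mul_modEq {N a b : ℤ}
    (h : ∀ k : ℤ, k ∣ N → k ∣ a → k ∣ b → IsUnit k) (c : ℤ) :
    ∃ r q : ℤ, r * a + b * q ≡ c [ZMOD N] := by
  have hco : IsCoprime N (Int.gcd a b : ℤ) := by
    rw [Int.isCoprime_iff_gcd_eq_one, ← Int.natAbs_natCast (Int.gcd N _), ← Int.isUnit_iff_natAbs_eq]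
    exact h _ (Int.gcd_dvd_left ..) ((Int.gcd_dvd_right ..).trans (Int.gcd_dvd_left ..))
      ((Int.gcd_dvd_right ..).trans (Int.gcd_dvd_right ..))
  obtain ⟨u, v, huv⟩ := hco
  rw [Int.gcd_eq_gcd_ab] at huv
  refine ⟨c * v * Int.gcdA a b, c * v * Int.gcdB a b, (Int.modEq_iff_dvd).2 ⟨c * u, ?_⟩⟩
  linear_combination (-c) * huv

/-- If `ζ₁ = 1 - mα` with `m ≥ 1` and `0 < 1 - mα < 1`, the extension `T_f` of the rotation by `α` is minimal iff `gcd(N, a₁, m·a₂) = 1`. -/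
theorem twoval_minimal_iff_of_eq_one_sub_mul_alpha
    (α : ℝ) (hα : α ∈ Ioo (0:ℝ) 1) (hirr : Irrational α) (N : ℕ) (hN : 2 ≤ N)
    (m : ℤ) (hm : 1 ≤ m) (a₁ a₂ : ℤ) (ζ : ℝ) (hζ : ζ = 1 - (m : ℝ) * α)
    (hζmem : ζ ∈ Ioo (0:ℝ) 1)  :
    MinimalExt (rot α) (twoval N ζ a₁ a₂) ↔
      ∀ k : ℤ, k ∣ (N : ℤ) → k ∣ a₁ → k ∣ m * a₂ → IsUnit k := by
  lift m to ℕ using by linarith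
  simp only [Int.cast_natCast] at hζ
  have hα0 := hα.1
  obtain ⟨hζ0, hζ1⟩ := id hζmem
  constructor
  · intro hmin k hkN hk1 hk2
    obtain ⟨n, hn, hn1⟩ := hmin 0 ⟨le_rfl, one_pos⟩ 0 (ζ / 2) ⟨by linarith, by linarith⟩ 1
      (ζ / 2) (by linarith)
    rw [skew_rot_iterate hζ hζmem N a₁ a₂ ⟨le_rfl, one_pos⟩] at hn hn1
    have ht := mem_Ioo_of_dist_coe_addCircle_lt
      ⟨Int.fract_nonneg _, Int.fract_lt_one _⟩ (by linarith) hn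
    have hG0 : floorSum α m 0 = 0 := floorSum_eq_zero hα0.le le_rfl (by linarith)
    have hGt := floorSum_eq_zero (m := m) hα0.le ht.1.le (by linarith [ht.2])
    rw [floorSum_eq_add_fract α m (0 + n * α), hG0, hGt] at hn1
    simp only [zero_add, add_zero, sub_zero] at hn1
    rw [← Int.cast_one, ZMod.intCast_eq_intCast_iff, Int.modEq_iff_dvd] at hn1
    obtain ⟨c, hc⟩ := hkN.trans hn1
    obtain ⟨d, hd⟩ := hk1
    obtain ⟨e, he⟩ := hk2
    refine isUnit_of_dvd_one ⟨c + n * d + e * ⌊n * α⌋ - d * m * ⌊n * α⌋, ?_⟩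
    linear_combination hc + (n - m * ⌊n * α⌋) * hd + ⌊n * α⌋ * he
  · intro h x hx s y hy u ε hε
    obtain ⟨δ, hδ, hG⟩ := exists_floorSum_eq_right α m y
    obtain ⟨c, hc⟩ := ZMod.intCast_surjective (u - s)
    have h' : ∀ k : ℤ, k ∣ (N : ℤ) → k ∣ a₁ → k ∣ m * (a₂ - a₁) → IsUnit k := by
      refine fun k hkN hk1 hk2 => h k hkN hk1 ?_
      have := dvd_add hk2 (hk1.mul_left m)
      rwa [← mul_add, sub_add_cancel] at this
    obtain ⟨r, q, hrq⟩ := exists_mul_add_mul_modEq h'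
      (c - (a₂ - a₁) * (floorSum α m y - floorSum α m x))
    have hyb : y < min 1 (y + min ε δ) := lt_min hy.2 (by linarith [lt_min hε hδ])
    obtain ⟨n, hnr, hnq, hl, hu⟩ := exists_fract_mem_Ioo_of_modEq hirr (by omega : 0 < N) x r q
      hy.1 hyb (min_le_left _ _)
    have hu' := hu.trans_le (min_le_right _ _)
    have hε' := min_le_left ε δ
    have hδ' := min_le_right ε δ
    refine ⟨n, ?_, ?_⟩
    · rw [skew_rot_iterate hζ hζmem N a₁ a₂ hx]
      refine (dist_coe_addCircle_le _ _).trans_lt ?_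
      rw [abs_lt]
      constructor <;> linarith
    · rw [skew_rot_iterate hζ hζmem N a₁ a₂ hx]
      simp only
      rw [← eq_sub_iff_add_eq', ← hc, ZMod.intCast_eq_intCast_iff, floorSum_eq_add_fract,
        hG _ ⟨hl.le, by linarith⟩]
      have hsum := (((hnr.mul_right a₁).add (hnq.mul_left (m * (a₂ - a₁)))).trans hrq).add_right
        ((a₂ - a₁) * (floorSum α m y - floorSum α m x))
      convert hsum using 1 <;> ring
end
end

section
/- Let α ∈ (0,1) be irrational, T the rotation of angle α viewed as a 2-interval exchange transformation on [0,1) with discontinuity 1 − α, N ≥ 2 an integer, and T_f the Veech 1969 type extension of T with two marked points 0 < ζ₁ < ζ₂ < 1 and integers a₁, a₂, a₃. Then: (a) if ζ₁ = 2α and ζ₂ ∉ ℤ + αℤ, T_f is minimal if and only if gcd(N, 2a₁, a₂, a₃) = 1; (b) if ζ₂ = 2α and ζ₁ ∉ ℤ + αℤ, T_f is minimal if and only if gcd(N, a₁ + a₂, 2a₂, a₃) = 1; (c) if ζ₁ = 2α and ζ₂ = 3α, T_f is minimal if and only if gcd(N, 2a₁ + a₂, a₃) = 1. -/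
open Set

noncomputable section

/-- The three-valued step function: `a₁` on `[0,ζ₁)`, `a₂` on `[ζ₁,ζ₂)` and `a₃` on `[ζ₂,1)`
(values in `ℤ/Nℤ`). -/
def threeval (N : ℕ) (ζ₁ ζ₂ : ℝ) (a₁ a₂ a₃ : ℤ) (x : ℝ) : ZMod N :=
  if x < ζ₁ then (a₁ : ZMod N) else if x < ζ₂ then (a₂ : ZMod N) else (a₃ : ZMod N)

section StepFunctions

open Filter Topology
open scoped Pointwise

/-- A function on `ℝ` that is locally constant to the right of every point (the point included)
and locally constant to the left of every point (the point excluded). -/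
def IsStep {β : Type*} (g : ℝ → β) : Prop :=
  ∀ x, (∀ᶠ y in 𝓝[>] x, g y = g x) ∧ ∃ L, ∀ᶠ y in 𝓝[<] x, g y = L

/-- `g` is constant on a neighbourhood of `x`. -/
def LocConstAt {β : Type*} (g : ℝ → β) (x : ℝ) : Prop :=
  ∀ᶠ y in 𝓝 x, g y = g x

section Basic

variable {β γ δ : Type*} {g : ℝ → β} {g' : ℝ → γ}

theorem IsStep.const (c : β) : IsStep (fun _ => c) :=
  fun _ => ⟨.of_forall fun _ => rfl, c, .of_forall fun _ => rfl⟩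

theorem IsStep.comp₂ (hg : IsStep g) (hg' : IsStep g') (φ : β → γ → δ) :
    IsStep fun x => φ (g x) (g' x) := by
  intro x
  obtain ⟨h₁, L, h₂⟩ := hg x
  obtain ⟨h₁', L', h₂'⟩ := hg' x
  refine ⟨?_, φ L L', ?_⟩
  · filter_upwards [h₁, h₁'] with y hy hy'
    rw [hy, hy']
  · filter_upwards [h₂, h₂'] with y hy hy'
    rw [hy, hy']

theorem IsStep.comp (hg : IsStep g) (φ : β → γ) : IsStep fun x => φ (g x) :=
  hg.comp₂ hg fun b _ => φ b

theorem tendsto_add_const_nhdsGT (x t : ℝ) :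
    Tendsto (fun y => y + t) (𝓝[>] x) (𝓝[>] (x + t)) := by
  refine tendsto_nhdsWithin_iff.2 ⟨?_, ?_⟩
  · exact ((continuous_add_const t).tendsto x).mono_left nhdsWithin_le_nhds
  · filter_upwards [self_mem_nhdsWithin] with y hy
    exact add_lt_add_left (show x < y from hy) t

theorem tendsto_add_const_nhdsLT (x t : ℝ) :
    Tendsto (fun y => y + t) (𝓝[<] x) (𝓝[<] (x + t)) := by
  refine tendsto_nhdsWithin_iff.2 ⟨?_, ?_⟩
  · exact ((continuous_add_const t).tendsto x).mono_left nhdsWithin_le_nhds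
  · filter_upwards [self_mem_nhdsWithin] with y hy
    exact add_lt_add_left (show y < x from hy) t

theorem IsStep.shift (hg : IsStep g) (t : ℝ) : IsStep fun x => g (x + t) := by
  intro x
  obtain ⟨h₁, L, h₂⟩ := hg (x + t)
  exact ⟨(tendsto_add_const_nhdsGT x t).eventually h₁, L,
    (tendsto_add_const_nhdsLT x t).eventually h₂⟩

theorem IsStep.floor : IsStep (fun x : ℝ => ⌊x⌋) := fun x =>
  ⟨tendsto_pure.1 ((tendsto_floor_right_pure_floor x).mono_left
    (nhdsWithin_mono _ Ioi_subset_Ici_self)), _,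
    tendsto_pure.1 (tendsto_floor_left_pure_ceil_sub_one x)⟩

theorem IsStep.floor_sub (t : ℝ) : IsStep (fun x : ℝ => ⌊x - t⌋) := by
  simpa only [sub_eq_add_neg] using IsStep.floor.shift (-t)

theorem IsStep.eventually_locConstAt (hg : IsStep g) (x : ℝ) :
    ∀ᶠ y in 𝓝[≠] x, LocConstAt g y := by
  obtain ⟨h₁, L, h₂⟩ := hg x
  have key : ∀ {s : Set ℝ} {c : β}, IsOpen s → (∀ᶠ y in 𝓝[s] x, g y = c) →
      ∀ᶠ y in 𝓝[s] x, LocConstAt g y := by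
    intro s c hs h
    filter_upwards [eventually_eventually_nhdsWithin.2 h, self_mem_nhdsWithin] with y hy hys
    rw [hs.nhdsWithin_eq hys] at hy
    have hc := hy.self_of_nhds
    filter_upwards [hy] with z hz
    rw [hz, hc]
  rw [← Iio_union_Ioi, nhdsWithin_union]
  exact eventually_sup.2 ⟨key isOpen_Iio h₂, key isOpen_Ioi h₁⟩

theorem LocConstAt.comp₂ {x : ℝ} (hg : LocConstAt g x) (hg' : LocConstAt g' x)
    (φ : β → γ → δ) : LocConstAt (fun y => φ (g y) (g' y)) x := by
  filter_upwards [hg, hg'] with y hy hy'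
  rw [hy, hy']

theorem LocConstAt.comp {x : ℝ} (hg : LocConstAt g x) (φ : β → γ) :
    LocConstAt (fun y => φ (g y)) x :=
  hg.comp₂ hg fun b _ => φ b

theorem LocConstAt.shift {x t : ℝ} (hg : LocConstAt g (x + t)) :
    LocConstAt (fun y => g (y + t)) x :=
  ((continuous_add_const t).tendsto x).eventually hg

theorem LocConstAt.of_shift {x t : ℝ} (hg : LocConstAt (fun y => g (y + t)) x) :
    LocConstAt g (x + t) := by
  have h : LocConstAt (fun y => g (y + t)) (x + t + -t) := by simpa using hg
  simpa using h.shift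

theorem locConstAt_floor_sub {x t : ℝ} (h : ∀ m : ℤ, x ≠ t + m) :
    LocConstAt (fun y : ℝ => ⌊y - t⌋) x := by
  have h₁ : (⌊x - t⌋ : ℝ) < x - t :=
    lt_of_le_of_ne (Int.floor_le _) fun he => h ⌊x - t⌋ (by linarith)
  filter_upwards [Ioo_mem_nhds (show t + ⌊x - t⌋ < x by linarith)
    (show x < t + ⌊x - t⌋ + 1 by linarith [Int.lt_floor_add_one (x - t)])] with y hy
  exact Int.floor_eq_iff.2 ⟨by linarith [hy.1], by linarith [hy.2]⟩

theorem eq_zero_of_locConstAt_floor_sub_zsmul {Q : Type*} [AddCommGroup Q] {t : ℝ} {c : Q}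
    (h : LocConstAt (fun y : ℝ => ⌊y - t⌋ • c) t) : c = 0 := by
  obtain ⟨l, hl, hls⟩ := (mem_nhds_iff_exists_Ioo_subset.1 h)
  obtain ⟨v, hlv, hvt⟩ := exists_between (max_lt hls.1.1 (sub_one_lt t))
  have hv := hls.2 (show v ∈ Ioo l hl from
    ⟨(le_max_left _ _).trans_lt hlv, hvt.trans hls.1.2⟩)
  have hf : ⌊v - t⌋ = -1 := Int.floor_eq_iff.2
    ⟨by push_cast; linarith [(le_max_right l (t - 1)).trans_lt hlv], by push_cast; linarith⟩
  simpa [hf] using hv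

end Basic

section Orbits

variable {α : ℝ}

theorem exists_small_orbit (hα : Irrational α) {ε : ℝ} (hε : 0 < ε) :
    ∃ n : ℕ, ∃ m : ℤ, (n * α + m : ℝ) ≠ 0 ∧ |(n * α + m : ℝ)| < ε := by
  obtain ⟨k, hk⟩ := exists_nat_one_div_lt hε
  obtain ⟨n, hn, -, h⟩ := Real.exists_nat_abs_mul_sub_round_le α k.succ_pos
  refine ⟨n, -round (n * α), ?_, ?_⟩
  · have := (hα.natCast_mul hn.ne').add_intCast (-round (n * α))
    exact this.ne_zero
  · push_cast
    rw [← sub_eq_add_neg]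
    refine h.trans_lt (lt_of_le_of_lt ?_ hk)
    push_cast
    gcongr
    linarith

theorem exists_orbit_mem_Ioo (hα : Irrational α) (x : ℝ) {a b : ℝ} (hab : a < b) :
    ∃ n : ℕ, ∃ m : ℤ, x + n * α + m ∈ Ioo a b := by
  obtain ⟨n, m, h0, hlt⟩ := exists_small_orbit hα (sub_pos.2 hab)
  set d : ℝ := n * α + m with hd
  have key : ∀ (j : ℕ) (l : ℤ), x + l + j * d ∈ Ioo a b →
      ∃ n : ℕ, ∃ m : ℤ, x + n * α + m ∈ Ioo a b := by
    intro j l h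
    refine ⟨j * n, j * m + l, ?_⟩
    convert h using 1
    push_cast
    rw [hd]
    ring
  rcases lt_or_gt_of_ne h0 with hneg | hpos
  · rw [abs_of_neg hneg] at hlt
    have h1 : b ≤ x + ⌈b - x⌉ := by linarith [Int.le_ceil (b - x)]
    have h2 := Nat.floor_le (div_nonneg (sub_nonneg.2 h1) (neg_pos.2 hneg).le)
    have h3 := Nat.lt_floor_add_one ((x + ⌈b - x⌉ - b) / -d)
    rw [le_div_iff₀ (neg_pos.2 hneg)] at h2
    rw [div_lt_iff₀ (neg_pos.2 hneg)] at h3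
    refine key (⌊(x + ⌈b - x⌉ - b) / -d⌋₊ + 1) ⌈b - x⌉ ⟨?_, ?_⟩ <;> push_cast <;> linarith
  · rw [abs_of_pos hpos] at hlt
    have h1 : x + ⌊a - x⌋ ≤ a := by linarith [Int.floor_le (a - x)]
    have h2 := Nat.floor_le (div_nonneg (sub_nonneg.2 h1) hpos.le)
    have h3 := Nat.lt_floor_add_one ((a - (x + ⌊a - x⌋)) / d)
    rw [le_div_iff₀ hpos] at h2
    rw [div_lt_iff₀ hpos] at h3
    refine key (⌊(a - (x + ⌊a - x⌋)) / d⌋₊ + 1) ⌊a - x⌋ ⟨?_, ?_⟩ <;> push_cast <;> linarith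

theorem exists_pos_orbit_of_eventually (hα : Irrational α) {x : ℝ} {p : ℝ → Prop}
    (hp : ∀ᶠ y in 𝓝[≠] x, p y) : ∃ n : ℕ, 0 < n ∧ ∃ m : ℤ, p (x + n * α + m) := by
  have hp' : ∀ᶠ y in 𝓝[>] x, p y :=
    hp.filter_mono (nhdsWithin_mono _ fun y (hy : x < y) => hy.ne')
  obtain ⟨b, hb, hbs⟩ := mem_nhdsGT_iff_exists_Ioo_subset.1 hp'
  obtain ⟨n, m, h₁, h₂⟩ := exists_orbit_mem_Ioo hα x
    (lt_min (show x < b from hb) (lt_add_one x))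
  refine ⟨n, Nat.pos_of_ne_zero ?_, m, hbs ⟨h₁, h₂.trans_le (min_le_left _ _)⟩⟩
  rintro rfl
  have h₃ := h₂.trans_le (min_le_right _ _)
  simp only [Nat.cast_zero, zero_mul, add_zero, lt_add_iff_pos_right, add_lt_add_iff_left]
    at h₁ h₃
  norm_cast at h₁ h₃
  lia

end Orbits

section Cohomology

variable {α : ℝ} {Q : Type*} [AddCommGroup Q]

theorem LocConstAt.of_add_int {β : Type*} {g : ℝ → β} {x : ℝ} (φ ψ : β → β)
    (h1 : ∀ y, φ (g (y + 1)) = g y) (h1' : ∀ y, ψ (g y) = g (y + 1))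
    {m : ℤ} (h : LocConstAt g (x + m)) : LocConstAt g x := by
  have hdown : ∀ z, LocConstAt g (z + 1) → LocConstAt g z := fun z hz => by
    simpa only [h1] using hz.shift.comp φ
  have hup : ∀ z, LocConstAt g z → LocConstAt g (z + 1) := fun z hz =>
    LocConstAt.of_shift (by simpa only [h1'] using hz.comp ψ)
  induction m using Int.induction_on with
  | zero => simpa using h
  | succ n ih => exact ih (hdown _ (by push_cast at h ⊢; rwa [add_assoc]))
  | pred n ih =>
    refine ih ?_
    have := hup _ h
    push_cast at this ⊢
    rwa [add_assoc, sub_add_cancel] at this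

/-- A step function whose increments under `x ↦ x + 1` and `x ↦ x + α` are constant is constant. -/
theorem IsStep.increments_eq_zero (hα : Irrational α) {g : ℝ → Q} (hg : IsStep g) {e b : Q}
    (he : ∀ x, g (x + 1) = g x + e) (hb : ∀ x, g (x + α) = g x + b) : e = 0 ∧ b = 0 := by
  have hloc : ∀ x, LocConstAt g x := by
    intro x
    obtain ⟨n, -, m, h⟩ := exists_pos_orbit_of_eventually hα (hg.eventually_locConstAt x)
    have h' : LocConstAt g (x + n * α) :=
      h.of_add_int (· - e) (· + e) (fun y => by simp [he]) fun y => (he y).symm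
    clear h
    induction n with
    | zero => simpa using h'
    | succ n ih =>
      refine ih ?_
      have h2 : LocConstAt g (x + n * α + α) := by
        convert h' using 1
        push_cast
        ring
      simpa [hb] using h2.shift.comp (· - b)
  have hlc : IsLocallyConstant g := (IsLocallyConstant.iff_eventually_eq g).2 hloc
  have hcst : ∀ x y, g x = g y := fun x y => hlc.apply_eq_of_preconnectedSpace x y
  exact ⟨by simpa [hcst 1 0] using he 0, by simpa [hcst α 0] using hb 0⟩

/-- If a step cocycle is a coboundary, then it is continuous at
`x` as soon as it is continuous at all other points of the orbit of `x`. -/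
theorem IsStep.locConstAt_of_coboundary (hα : Irrational α) {h F : ℝ → Q} (hh : IsStep h)
    (hper : ∀ x, h (x + 1) = h x) (hF : ∀ x, h (x + α) = h x + F x) {x : ℝ}
    (hpos : ∀ n : ℕ, 0 < n → LocConstAt F (x + n * α))
    (hneg : ∀ n : ℕ, 0 < n → LocConstAt F (x - n * α)) : LocConstAt F x := by
  have hint : ∀ (y : ℝ) (m : ℤ), LocConstAt h (y + m) → LocConstAt h y := fun y m hy =>
    hy.of_add_int id id (fun z => by simp [hper]) fun z => by simp [hper]
  have h₀ : LocConstAt h x := by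
    obtain ⟨n, hn, m, hm⟩ := exists_pos_orbit_of_eventually hα.neg (hh.eventually_locConstAt x)
    have h' := hint _ _ hm
    clear hm hn
    induction n with
    | zero => simpa using h'
    | succ n ih =>
      refine ih ?_
      have hFn := hneg (n + 1) n.succ_pos
      have e : x + ((n + 1 : ℕ) : ℝ) * -α = x - ((n + 1 : ℕ) : ℝ) * α := by ring
      rw [e] at h'
      have h2 := (h'.comp₂ hFn (· + ·))
      simp only [← hF] at h2
      convert h2.of_shift using 1
      push_cast
      ring
  have h₁ : LocConstAt h (x + α) := by
    obtain ⟨n, hn, m, hm⟩ := exists_pos_orbit_of_eventually hα (hh.eventually_locConstAt (x + α))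
    have h' := hint _ _ hm
    clear hm hn
    induction n with
    | zero => simpa using h'
    | succ n ih =>
      refine ih ?_
      have hFn := hpos (n + 1) n.succ_pos
      have e : x + α + ((n + 1 : ℕ) : ℝ) * α = x + ((n + 1 : ℕ) : ℝ) * α + α := by ring
      rw [e] at h'
      have h2 := h'.shift.comp₂ hFn (· - ·)
      simp only [hF, add_sub_cancel_right] at h2
      convert h2 using 1
      push_cast
      ring
  have h2 := h₁.shift.comp₂ h₀ (· - ·)
  simpa only [hF, add_sub_cancel_left] using h2

end Cohomology

section Birkhoff

variable {α : ℝ} {G : Type*} [AddCommGroup G]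

/-- The Birkhoff sum of `F` along the first `n` points of the orbit of `x` under `x ↦ x + α`. -/
def birkhoff (α : ℝ) (F : ℝ → G) (n : ℕ) (x : ℝ) : G :=
  ∑ i ∈ Finset.range n, F (x + i * α)

theorem birkhoff_succ (F : ℝ → G) (n : ℕ) (x : ℝ) :
    birkhoff α F (n + 1) x = birkhoff α F n x + F (x + n * α) :=
  Finset.sum_range_succ _ _

theorem birkhoff_succ' (F : ℝ → G) (n : ℕ) (x : ℝ) :
    birkhoff α F (n + 1) x = F x + birkhoff α F n (x + α) := by
  rw [birkhoff, Finset.sum_range_succ', add_comm, birkhoff]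
  congr 1
  · simp
  · refine Finset.sum_congr rfl fun i _ => ?_
    congr 1
    push_cast
    ring

theorem birkhoff_add_one {F : ℝ → G} (hF : ∀ x, F (x + 1) = F x) (n : ℕ) (x : ℝ) :
    birkhoff α F n (x + 1) = birkhoff α F n x := by
  refine Finset.sum_congr rfl fun i _ => ?_
  rw [add_right_comm, hF]

theorem IsStep.birkhoff {F : ℝ → G} (hF : IsStep F) (n : ℕ) : IsStep (birkhoff α F n) := by
  induction n with
  | zero => simpa [_root_.birkhoff, funext_iff] using! IsStep.const (0 : G)
  | succ n ih => simpa only [← birkhoff_succ] using! ih.comp₂ (hF.shift (n * α)) (· + ·)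

theorem eq_of_periodic {β : Type*} {g : ℝ → β} (h : ∀ x, g (x + 1) = g x) (x : ℝ) (m : ℤ) :
    g (x + m) = g x := by
  simpa using Function.Periodic.int_mul (f := g) (c := 1) h m x

/-- If some orbit of the skew product misses a nonempty box, then the cocycle is a coboundary
modulo a proper subgroup. -/
theorem exists_coboundary_of_missed_box [Finite G] (hα : Irrational α) {F : ℝ → G}
    (hF : IsStep F) (hper : ∀ x, F (x + 1) = F x) {x₀ a b : ℝ} {s₀ u : G} (hab : a < b)
    (hmiss : ∀ (n : ℕ) (m : ℤ), x₀ + n * α + m ∈ Ico a b → s₀ + birkhoff α F n x₀ ≠ u) :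
    ∃ H : AddSubgroup G, H ≠ ⊤ ∧ ∃ h : ℝ → G ⧸ H, IsStep h ∧ (∀ x, h (x + 1) = h x) ∧
      ∀ x, h (x + α) = h x + (F x : G ⧸ H) := by
  classical
  set W : ℝ → Set G := fun x =>
    {s | ∃ (n : ℕ) (m : ℤ), x + n * α + m ∈ Ico a b ∧ s + birkhoff α F n x = u} with hW
  have hW1 : ∀ x, W (x + 1) = W x := by
    intro x
    ext s
    constructor
    · rintro ⟨n, m, hm, hs⟩
      refine ⟨n, m + 1, ?_, by rwa [birkhoff_add_one hper] at hs⟩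
      convert hm using 1
      push_cast
      ring
    · rintro ⟨n, m, hm, hs⟩
      refine ⟨n, m - 1, ?_, by rwa [birkhoff_add_one hper]⟩
      convert hm using 1
      push_cast
      ring
  have hsub : ∀ x, F x +ᵥ W x ⊇ W (x + α) := by
    rintro x s ⟨n, m, hm, hs⟩
    refine Set.mem_vadd_set.2 ⟨s - F x, ⟨n + 1, m, ?_, ?_⟩, by simp⟩
    · convert hm using 1
      push_cast
      ring
    · rw [birkhoff_succ', ← hs]
      abel
  have hcard_step : ∀ x, (W (x + α)).ncard ≤ (W x).ncard := fun x =>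
    (Set.ncard_le_ncard (hsub x) (Set.toFinite _)).trans (Set.ncard_image_le (Set.toFinite _))
  have hcard_orbit : ∀ x (n : ℕ) (m : ℤ), (W (x + n * α + m)).ncard ≤ (W x).ncard := by
    intro x n m
    rw [eq_of_periodic hW1]
    induction n with
    | zero => simp
    | succ n ih =>
      refine le_trans (le_of_eq ?_) ((hcard_step (x + n * α)).trans ih)
      congr 2
      push_cast
      ring
  have hright_sub : ∀ x, ∀ᶠ y in 𝓝[>] x, W x ⊆ W y := by
    intro x
    have : ∀ s ∈ W x, ∀ᶠ y in 𝓝[>] x, s ∈ W y := by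
      rintro s ⟨n, m, hm, hs⟩
      filter_upwards [(hF.birkhoff (α := α) n x).1, self_mem_nhdsWithin,
        nhdsWithin_le_nhds (Iio_mem_nhds (show x < b - n * α - m by linarith [hm.2]))]
        with y hy hxy hyb
      refine ⟨n, m, ⟨?_, ?_⟩, by rw [hy, hs]⟩
      · linarith [hm.1, show x < y from hxy]
      · linarith [show y < _ from hyb]
    exact (Filter.eventually_all_finite (Set.toFinite (W x))).2 this
  obtain ⟨x₁, hx₁⟩ : ∃ x₁, ∀ x, (W x).ncard ≤ (W x₁).ncard := by
    have hbd : (Set.range fun x => (W x).ncard).Finite :=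
      (Set.finite_Iic (Nat.card G)).subset (by rintro _ ⟨x, rfl⟩; exact Set.ncard_le_card _)
    obtain ⟨_, ⟨x₁, rfl⟩, h⟩ := hbd.exists_maximal (Set.range_nonempty _)
    exact ⟨x₁, fun x => (le_total _ _).elim id fun hle => h ⟨x, rfl⟩ hle⟩
  have hcard : ∀ x, (W x).ncard = (W x₁).ncard := by
    intro x
    obtain ⟨c, hc, hcs⟩ := mem_nhdsGT_iff_exists_Ioo_subset.1 (hright_sub x₁)
    obtain ⟨n, m, hn⟩ := exists_orbit_mem_Ioo hα x (show x₁ < c from hc)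
    exact (hx₁ x).antisymm
      ((Set.ncard_le_ncard (hcs hn) (Set.toFinite _)).trans (hcard_orbit x n m))
  have hcoc : ∀ x, W (x + α) = F x +ᵥ W x := fun x =>
    Set.eq_of_subset_of_ncard_le (hsub x)
      ((Set.ncard_image_le (Set.toFinite _)).trans (by rw [hcard, hcard (x + α)])) (Set.toFinite _)
  have hcoc_orbit : ∀ (n : ℕ) (m : ℤ) x, W (x + n * α + m) = birkhoff α F n x +ᵥ W x := by
    intro n m x
    rw [eq_of_periodic hW1]
    induction n with
    | zero => simp [birkhoff]
    | succ n ih =>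
      rw [birkhoff_succ, add_comm (birkhoff _ _ _ _), ← vadd_vadd, ← ih, ← hcoc]
      congr 1
      push_cast
      ring
  have hcoc_neg : ∀ (n : ℕ) (m : ℤ) x, W x = -birkhoff α F n x +ᵥ W (x + n * α + m) := by
    intro n m x
    rw [hcoc_orbit, neg_vadd_vadd]
  have hright : ∀ x, ∀ᶠ y in 𝓝[>] x, W y = W x := fun x =>
    (hright_sub x).mono fun y hy =>
      (Set.eq_of_subset_of_ncard_le hy (by rw [hcard, hcard x]) (Set.toFinite _)).symm
  obtain ⟨c, hc, hcs⟩ := mem_nhdsGT_iff_exists_Ioo_subset.1 (hright 0)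
  have hreach : ∀ x, ∃ (n : ℕ) (m : ℤ), x + n * α + m ∈ Ioo 0 c := fun x =>
    exists_orbit_mem_Ioo hα x hc
  have hstepW : IsStep W := by
    refine fun x => ⟨hright x, ?_⟩
    obtain ⟨n, m, hn⟩ := hreach x
    obtain ⟨L, hL⟩ := (hF.birkhoff (α := α) n x).2
    refine ⟨-L +ᵥ W 0, ?_⟩
    have hcont : Tendsto (fun y : ℝ => y + n * α + m) (𝓝[<] x) (𝓝 (x + n * α + m)) :=
      ((by fun_prop : Continuous fun y : ℝ => y + n * α + m).tendsto x).mono_left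
        nhdsWithin_le_nhds
    filter_upwards [hL, hcont.eventually (Ioo_mem_nhds hn.1 hn.2)] with y hy hyc
    rw [hcoc_neg n m y, hy, hcs hyc]
  have htrans : ∀ x, ∃ g : G, W x = g +ᵥ W 0 := by
    intro x
    obtain ⟨n, m, hn⟩ := hreach x
    exact ⟨_, by rw [hcoc_neg n m x, hcs hn]⟩
  set H := AddAction.stabilizer G (W 0) with hH
  have hmk : ∀ g g' : G, g +ᵥ W 0 = g' +ᵥ W 0 → (g : G ⧸ H) = g' := by
    intro g g' h
    rw [QuotientAddGroup.eq, hH, AddAction.mem_stabilizer_iff, ← vadd_vadd, ← h, neg_vadd_vadd]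
  set q : Set G → G ⧸ H := fun B =>
    if hB : ∃ g : G, B = g +ᵥ W 0 then (hB.choose : G ⧸ H) else 0 with hq
  have hqv : ∀ g : G, q (g +ᵥ W 0) = g := by
    intro g
    have hB : ∃ g' : G, g +ᵥ W 0 = g' +ᵥ W 0 := ⟨g, rfl⟩
    simp only [hq, dif_pos hB]
    exact (hmk _ _ hB.choose_spec).symm
  refine ⟨H, ?_, fun x => q (W x), hstepW.comp q, fun x => congrArg q (hW1 x), fun x => ?_⟩
  · intro htop
    have hne : (W 0).Nonempty := by
      have ha : (W a).Nonempty := ⟨u, 0, 0, by simpa using hab, by simp [birkhoff]⟩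
      rw [← Set.ncard_pos (Set.toFinite _)] at ha ⊢
      rwa [hcard, ← hcard a]
    obtain ⟨t, ht⟩ := hne
    obtain ⟨g, hg⟩ := htrans x₀
    have hst : s₀ ∉ W x₀ := fun ⟨n, m, hm, hs⟩ => hmiss n m hm hs
    apply hst
    have hmem : s₀ - g - t ∈ H := htop ▸ AddSubgroup.mem_top _
    rw [hH, AddAction.mem_stabilizer_iff] at hmem
    rw [hg, ← hmem]
    refine Set.mem_vadd_set.2 ⟨s₀ - g, Set.mem_vadd_set.2 ⟨t, ht, ?_⟩, ?_⟩ <;>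
      simp
  · obtain ⟨g, hg⟩ := htrans x
    simp only [hcoc, hg, hqv, vadd_vadd]
    rw [QuotientAddGroup.mk_add, add_comm]

end Birkhoff

section SkewProduct

variable {α : ℝ} {N : ℕ}

theorem rot_fract (x : ℝ) : rot α (Int.fract x) = Int.fract (x + α) := by
  rw [rot, Int.fract_eq_fract]
  exact ⟨-⌊x⌋, by rw [Int.fract]; push_cast; ring⟩

theorem skew_iterate {f F : ℝ → ZMod N} (hper : ∀ x, F (x + 1) = F x)
    (hf : ∀ x ∈ Ico (0 : ℝ) 1, f x = F x) {x : ℝ} (hx : x ∈ Ico (0 : ℝ) 1) (s : ZMod N) (n : ℕ) :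
    (skew (rot α) f)^[n] (x, s) = (Int.fract (x + n * α), s + birkhoff α F n x) := by
  induction n with
  | zero => simp [birkhoff, Int.fract_eq_self.2 hx]
  | succ n ih =>
    rw [Function.iterate_succ_apply', ih, skew]
    refine Prod.ext ?_ ?_
    · simp only [rot_fract]
      congr 1
      push_cast
      ring
    · simp only
      rw [birkhoff_succ, add_assoc, hf _ ⟨Int.fract_nonneg _, Int.fract_lt_one _⟩]
      congr 2
      have := eq_of_periodic hper (Int.fract (x + n * α)) ⌊x + n * α⌋
      rwa [Int.fract_add_floor, eq_comm] at this

/-- A failure of minimality makes the cocycle a coboundary modulo a proper subgroup. -/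
theorem exists_coboundary_of_not_minimalExt [NeZero N] (hα : Irrational α) {f F : ℝ → ZMod N}
    (hF : IsStep F) (hper : ∀ x, F (x + 1) = F x) (hf : ∀ x ∈ Ico (0 : ℝ) 1, f x = F x)
    (hmin : ¬ MinimalExt (rot α) f) :
    ∃ H : AddSubgroup (ZMod N), H ≠ ⊤ ∧ ∃ h : ℝ → ZMod N ⧸ H, IsStep h ∧
      (∀ x, h (x + 1) = h x) ∧ ∀ x, h (x + α) = h x + (F x : ZMod N ⧸ H) := by
  simp only [MinimalExt, not_forall, not_exists, not_and] at hmin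
  obtain ⟨x, hx, s, y, hy, u, ε, hε, h⟩ := hmin
  refine exists_coboundary_of_missed_box hα hF hper (x₀ := x) (s₀ := s) (u := u)
    (lt_add_of_pos_right y hε) fun n m hm => ?_
  have := h n
  rw [skew_iterate hper hf hx] at this
  refine this ?_
  rw [dist_eq_norm, ← QuotientAddGroup.mk_sub]
  refine (UnitAddCircle.norm_eq (x := Int.fract (x + n * α) - y)).trans_lt ?_
  refine (round_le _ (-(m + ⌊x + n * α⌋))).trans_lt ?_
  rw [Int.fract]
  push_cast
  rw [abs_lt]
  constructor <;> linarith [hm.1, hm.2]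

/-- If the cocycle is a coboundary after a homomorphism `π`, then minimality forces `π` to
vanish. -/
theorem MinimalExt.apply_eq_zero {f F : ℝ → ZMod N}
    (hmin : MinimalExt (rot α) f) (hper : ∀ x, F (x + 1) = F x)
    (hf : ∀ x ∈ Ico (0 : ℝ) 1, f x = F x) {Q : Type*} [AddCommGroup Q] (π : ZMod N →+ Q)
    {h : ℝ → Q} (hh : IsStep h) (hh1 : ∀ x, h (x + 1) = h x)
    (hhα : ∀ x, h (x + α) = h x + π (F x)) (u : ZMod N) : π u = 0 := by
  obtain ⟨c, hc, hcs⟩ := mem_nhdsGT_iff_exists_Ioo_subset.1 (hh 0).1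
  set d := min c 1 with hd
  have hd0 : 0 < d := lt_min hc one_pos
  have hd1 : d ≤ 1 := min_le_right _ _
  obtain ⟨n, hn, hu⟩ := hmin 0 ⟨le_rfl, one_pos⟩ 0 (d / 2) ⟨by linarith, by linarith⟩ u (d / 4)
    (by linarith)
  rw [skew_iterate hper hf ⟨le_rfl, one_pos⟩] at hn hu
  simp only [zero_add] at hn hu
  have hsum : ∀ n : ℕ, h (n * α) = h 0 + π (birkhoff α F n 0) := by
    intro n
    induction n with
    | zero => simp [birkhoff]
    | succ n ih =>
      rw [birkhoff_succ, map_add, ← add_assoc, ← ih, zero_add, ← hhα]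
      congr 1
      push_cast
      ring
  have hfr : h (Int.fract (n * α)) = h 0 := by
    set z := Int.fract (n * α) with hz
    have hz0 : 0 ≤ z := Int.fract_nonneg _
    have hz1 : z < 1 := Int.fract_lt_one _
    rw [dist_eq_norm, ← QuotientAddGroup.mk_sub] at hn
    have hn' := (UnitAddCircle.norm_eq (x := z - d / 2)).symm.trans_lt hn
    rw [abs_lt] at hn'
    have hr1 : (-1 : ℝ) < round (z - d / 2) := by linarith
    have hr2 : (round (z - d / 2) : ℝ) < 1 := by linarith
    have hr : round (z - d / 2) = 0 := by
      norm_cast at hr1 hr2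
      lia
    rw [hr] at hn'
    push_cast at hn'
    exact hcs ⟨by linarith, by linarith [min_le_left c 1]⟩
  have hfl := eq_of_periodic hh1 (Int.fract (n * α)) ⌊n * α⌋
  rw [Int.fract_add_floor, hfr, hsum, hu] at hfl
  simpa using hfl

end SkewProduct

section StepCocycle

variable {α ζ₁ ζ₂ : ℝ} {Q : Type*} [AddCommGroup Q] {a b c : Q}

/-- The `1`-periodic function on `ℝ` with values `a` on `[0,ζ₁)`, `b` on `[ζ₁,ζ₂)` and `c` on
`[ζ₂,1)`. -/
def stepCocycle (ζ₁ ζ₂ : ℝ) (a b c : Q) (x : ℝ) : Q :=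
  c + (⌊x⌋ - ⌊x - ζ₁⌋) • (a - c) + (⌊x - ζ₁⌋ - ⌊x - ζ₂⌋) • (b - c)

theorem IsStep.stepCocycle : IsStep (stepCocycle ζ₁ ζ₂ a b c) :=
  ((IsStep.floor.comp₂ (IsStep.floor_sub ζ₁) fun m n => c + (m - n) • (a - c)).comp₂
    ((IsStep.floor_sub ζ₁).comp₂ (IsStep.floor_sub ζ₂) fun m n => (m - n) • (b - c)) (· + ·))

theorem floor_add_one_sub (x t : ℝ) : ⌊x + 1 - t⌋ = ⌊x - t⌋ + 1 := by
  rw [add_sub_right_comm, Int.floor_add_one]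

theorem stepCocycle_add_one (x : ℝ) :
    stepCocycle ζ₁ ζ₂ a b c (x + 1) = stepCocycle ζ₁ ζ₂ a b c x := by
  simp [stepCocycle, floor_add_one_sub]

theorem map_stepCocycle {R : Type*} [AddCommGroup R] (π : Q →+ R) (x : ℝ) :
    π (stepCocycle ζ₁ ζ₂ a b c x) = stepCocycle ζ₁ ζ₂ (π a) (π b) (π c) x := by
  simp [stepCocycle]

theorem threeval_eq_stepCocycle {N : ℕ} (hζ : 0 < ζ₁ ∧ ζ₁ < ζ₂ ∧ ζ₂ < 1) (a₁ a₂ a₃ : ℤ) {x : ℝ}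
    (hx : x ∈ Ico (0 : ℝ) 1) :
    threeval N ζ₁ ζ₂ a₁ a₂ a₃ x = stepCocycle ζ₁ ζ₂ (a₁ : ZMod N) a₂ a₃ x := by
  obtain ⟨h0, h1⟩ := hx
  obtain ⟨h2, h3, h4⟩ := hζ
  have hf : ⌊x⌋ = 0 := Int.floor_eq_zero_iff.2 ⟨h0, h1⟩
  have hlt : ∀ ζ, ζ < 1 → x < ζ → ⌊x - ζ⌋ = -1 := fun ζ _ _ =>
    Int.floor_eq_iff.2 ⟨by push_cast; linarith, by push_cast; linarith⟩
  have hge : ∀ ζ, 0 < ζ → ζ ≤ x → ⌊x - ζ⌋ = 0 := fun ζ _ _ =>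
    Int.floor_eq_iff.2 ⟨by push_cast; linarith, by push_cast; linarith⟩
  rw [threeval, stepCocycle, hf]
  split_ifs with h5 h6
  · simp [hlt ζ₁ (by linarith) h5, hlt ζ₂ h4 (by linarith)]
  · simp [hge ζ₁ h2 (not_lt.1 h5), hlt ζ₂ h4 h6]
  · simp [hge ζ₁ h2 (not_lt.1 h5), hge ζ₂ (by linarith) (not_lt.1 h6)]

theorem locConstAt_stepCocycle {x : ℝ} (h₀ : ∀ m : ℤ, x ≠ m) (h₁ : ∀ m : ℤ, x ≠ ζ₁ + m)
    (h₂ : ∀ m : ℤ, x ≠ ζ₂ + m) : LocConstAt (stepCocycle ζ₁ ζ₂ a b c) x := by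
  have h0 : LocConstAt (fun y : ℝ => ⌊y⌋) x := by
    simpa using locConstAt_floor_sub (x := x) (t := 0) (by simpa using h₀)
  have h1 := locConstAt_floor_sub h₁
  exact (h0.comp₂ h1 fun m n => c + (m - n) • (a - c)).comp₂
    (h1.comp₂ (locConstAt_floor_sub h₂) fun m n => (m - n) • (b - c)) (· + ·)

theorem eq_of_locConstAt_stepCocycle_left (h₀ : ∀ m : ℤ, ζ₁ ≠ m) (h₂ : ∀ m : ℤ, ζ₁ ≠ ζ₂ + m)
    (h : LocConstAt (stepCocycle ζ₁ ζ₂ a b c) ζ₁) : a = b := by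
  have h0 : LocConstAt (fun y : ℝ => ⌊y⌋) ζ₁ := by
    simpa using locConstAt_floor_sub (x := ζ₁) (t := 0) (by simpa using h₀)
  have h' := h.comp₂ (h0.comp₂ (locConstAt_floor_sub h₂)
    fun m n => c + m • (a - c) - n • (b - c)) (fun p q => q - p)
  refine sub_eq_zero.1 (eq_zero_of_locConstAt_floor_sub_zsmul (t := ζ₁) ?_)
  convert h' using 2 with y
  simp only [stepCocycle]
  module

theorem eq_of_locConstAt_stepCocycle_right (h₀ : ∀ m : ℤ, ζ₂ ≠ m) (h₁ : ∀ m : ℤ, ζ₂ ≠ ζ₁ + m)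
    (h : LocConstAt (stepCocycle ζ₁ ζ₂ a b c) ζ₂) : b = c := by
  have h0 : LocConstAt (fun y : ℝ => ⌊y⌋) ζ₂ := by
    simpa using locConstAt_floor_sub (x := ζ₂) (t := 0) (by simpa using h₀)
  have h' := h.comp₂ (h0.comp₂ (locConstAt_floor_sub h₁)
    fun m n => c + (m - n) • (a - c) + n • (b - c)) (fun p q => q - p)
  refine sub_eq_zero.1 (eq_zero_of_locConstAt_floor_sub_zsmul (t := ζ₂) ?_)
  convert h' using 2 with y
  simp only [stepCocycle]
  module

/-- `F` is the coboundary, over the rotation of angle `α`, of a `1`-periodic step function. -/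
def IsStepCoboundary (α : ℝ) (F : ℝ → Q) : Prop :=
  ∃ h : ℝ → Q, IsStep h ∧ (∀ x, h (x + 1) = h x) ∧ ∀ x, h (x + α) = h x + F x

theorem isStepCoboundary_two_three_iff (hα : Irrational α) :
    IsStepCoboundary α (stepCocycle (2 * α) (3 * α) a b c) ↔ 2 • a + b = 0 ∧ c = 0 := by
  set k : ℝ → Q := fun x =>
    ⌊x - α⌋ • (a - c) + ⌊x - 2 * α⌋ • (a - c) + ⌊x - 3 * α⌋ • (b - c) with hk
  have hkstep : IsStep k :=
    ((IsStep.floor_sub α).comp₂ (IsStep.floor_sub (2 * α))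
      fun m n => m • (a - c) + n • (a - c)).comp₂ (IsStep.floor_sub (3 * α))
      fun p n => p + n • (b - c)
  have hk1 : ∀ x, k (x + 1) = k x + (2 • (a - c) + (b - c)) := by
    intro x
    simp only [hk, floor_add_one_sub]
    module
  have hkα : ∀ x, k (x + α) = k x + (stepCocycle (2 * α) (3 * α) a b c x - c) := by
    intro x
    simp only [hk, stepCocycle]
    rw [add_sub_cancel_right, show x + α - 2 * α = x - α by ring,
      show x + α - 3 * α = x - 2 * α by ring]
    module
  constructor
  · rintro ⟨h, hh, hh1, hhα⟩
    obtain ⟨h1, h2⟩ := (hh.comp₂ hkstep (· - ·)).increments_eq_zero hα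
      (e := -(2 • (a - c) + (b - c))) (b := c)
      (fun x => by rw [hh1, hk1]; abel) (fun x => by rw [hhα, hkα]; abel)
    subst h2
    exact ⟨by simpa only [sub_zero, neg_eq_zero] using h1, rfl⟩
  · rintro ⟨h1, rfl⟩
    exact ⟨k, hkstep, fun x => by simpa [h1] using hk1 x, fun x => by simpa using hkα x⟩

theorem stepCocycle_of_eq_right (a c : Q) (ζ₁ ζ₂ ζ₂' : ℝ) :
    stepCocycle ζ₁ ζ₂ a c c = stepCocycle ζ₁ ζ₂' a c c := by
  funext x
  simp [stepCocycle]

theorem stepCocycle_of_eq_left (b c : Q) (ζ₁ ζ₂ ζ₂' : ℝ) :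
    stepCocycle ζ₁ ζ₂ b b c = stepCocycle ζ₂ ζ₂' b c c := by
  funext x
  simp only [stepCocycle]
  module

theorem isStepCoboundary_left_iff (hα : Irrational α) (hζ₂ : ¬ ∃ m n : ℤ, ζ₂ = m * α + n) :
    IsStepCoboundary α (stepCocycle (2 * α) ζ₂ a b c) ↔ 2 • a = 0 ∧ b = 0 ∧ c = 0 := by
  constructor
  · intro h
    have hbc : b = c := by
      obtain ⟨g, hg, hg1, hgα⟩ := h
      refine eq_of_locConstAt_stepCocycle_right (fun m hm => hζ₂ ⟨0, m, by simp [hm]⟩)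
        (fun m hm => hζ₂ ⟨2, m, by simp [hm]⟩)
        (hg.locConstAt_of_coboundary hα hg1 hgα (fun n hn => ?_) fun n hn => ?_) <;>
      refine locConstAt_stepCocycle (fun m hm => hζ₂ ?_) (fun m hm => hζ₂ ?_)
        fun m hm => (hα.natCast_mul hn.ne').ne_int ?_ ?_
      · exact ⟨-n, m, by push_cast; linarith⟩
      · exact ⟨2 - n, m, by push_cast; linarith⟩
      · exact m
      · linarith
      · exact ⟨n, m, by push_cast; linarith⟩
      · exact ⟨2 + n, m, by push_cast; linarith⟩
      · exact -m
      · push_cast; linarith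
    subst hbc
    rw [stepCocycle_of_eq_right a b _ _ (3 * α), isStepCoboundary_two_three_iff hα] at h
    obtain ⟨h1, rfl⟩ := h
    simpa using h1
  · rintro ⟨h1, rfl, rfl⟩
    rw [stepCocycle_of_eq_right a 0 _ _ (3 * α), isStepCoboundary_two_three_iff hα]
    simpa using h1

theorem isStepCoboundary_right_iff (hα : Irrational α) (hζ₁ : ¬ ∃ m n : ℤ, ζ₁ = m * α + n) :
    IsStepCoboundary α (stepCocycle ζ₁ (2 * α) a b c) ↔ a + b = 0 ∧ 2 • b = 0 ∧ c = 0 := by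
  constructor
  · intro h
    have hab : a = b := by
      obtain ⟨g, hg, hg1, hgα⟩ := h
      refine eq_of_locConstAt_stepCocycle_left (fun m hm => hζ₁ ⟨0, m, by simp [hm]⟩)
        (fun m hm => hζ₁ ⟨2, m, by simp [hm]⟩)
        (hg.locConstAt_of_coboundary hα hg1 hgα (fun n hn => ?_) fun n hn => ?_) <;>
      refine locConstAt_stepCocycle (fun m hm => hζ₁ ?_)
        (fun m hm => (hα.natCast_mul hn.ne').ne_int ?_ ?_) fun m hm => hζ₁ ?_
      · exact ⟨-n, m, by push_cast; linarith⟩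
      · exact m
      · linarith
      · exact ⟨2 - n, m, by push_cast; linarith⟩
      · exact ⟨n, m, by push_cast; linarith⟩
      · exact -m
      · push_cast; linarith
      · exact ⟨2 + n, m, by push_cast; linarith⟩
    subst hab
    rw [stepCocycle_of_eq_left a c _ _ (3 * α), isStepCoboundary_two_three_iff hα] at h
    obtain ⟨h1, rfl⟩ := h
    rw [add_zero] at h1
    exact ⟨by rw [← two_nsmul, h1], h1, rfl⟩
  · rintro ⟨h1, h2, rfl⟩
    obtain rfl : a = b := by
      rw [two_nsmul] at h2
      exact add_right_cancel (h1.trans h2.symm)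
    rw [stepCocycle_of_eq_left a 0 _ _ (3 * α), isStepCoboundary_two_three_iff hα]
    simpa using h2

end StepCocycle

section Minimality

variable {α ζ₁ ζ₂ : ℝ} {N : ℕ}

theorem exists_not_isUnit_dvd_of_ne_top {H : AddSubgroup (ZMod N)} (hH : H ≠ ⊤) :
    ∃ k : ℤ, ¬ IsUnit k ∧ k ∣ N ∧ ∀ a : ℤ, ((a : ZMod N) : ZMod N ⧸ H) = 0 → k ∣ a := by
  obtain ⟨k, hk⟩ := Int.subgroup_cyclic (H.comap (Int.castAddHom (ZMod N)))
  have hmem : ∀ a : ℤ, (a : ZMod N) ∈ H ↔ k ∣ a := by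
    intro a
    rw [← Int.mem_zmultiples_iff, AddSubgroup.zmultiples_eq_closure, ← hk]
    rfl
  refine ⟨k, fun hu => hH ?_, (hmem N).1 (by simp), fun a ha => ?_⟩
  · rw [eq_top_iff]
    rintro z -
    obtain ⟨a, rfl⟩ := ZMod.intCast_surjective z
    exact (hmem a).2 hu.dvd
  · exact (hmem a).1 ((QuotientAddGroup.eq_zero_iff _).1 ha)

/-- To decide minimality, it suffices to decide when step cocycles are coboundaries. -/
theorem minimalExt_iff_of_isStepCoboundary_iff [NeZero N] (hα : Irrational α)
    (hζ : 0 < ζ₁ ∧ ζ₁ < ζ₂ ∧ ζ₂ < 1) (a₁ a₂ a₃ : ℤ) {P : ℤ → Prop}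
    (hP : ∀ k : ℤ, k ∣ N → P k →
      IsStepCoboundary α (stepCocycle ζ₁ ζ₂ (a₁ : ZMod k.natAbs) a₂ a₃))
    (hP' : ∀ (H : AddSubgroup (ZMod N)) (k : ℤ),
      (∀ a : ℤ, ((a : ZMod N) : ZMod N ⧸ H) = 0 → k ∣ a) →
      IsStepCoboundary α (stepCocycle ζ₁ ζ₂ ((a₁ : ZMod N) : ZMod N ⧸ H) (a₂ : ZMod N)
        (a₃ : ZMod N)) → P k) :
    MinimalExt (rot α) (threeval N ζ₁ ζ₂ a₁ a₂ a₃) ↔ ∀ k : ℤ, k ∣ N → P k → IsUnit k := by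
  have hf : ∀ x ∈ Ico (0 : ℝ) 1, threeval N ζ₁ ζ₂ a₁ a₂ a₃ x =
      stepCocycle ζ₁ ζ₂ (a₁ : ZMod N) a₂ a₃ x := fun x => threeval_eq_stepCocycle hζ a₁ a₂ a₃
  constructor
  · intro hmin k hkN hk
    obtain ⟨h, hh, hh1, hhα⟩ := hP k hkN hk
    have hdvd : k.natAbs ∣ N := Int.natAbs_dvd_natAbs.2 hkN
    have h1 := hmin.apply_eq_zero stepCocycle_add_one hf
      (ZMod.castHom hdvd (ZMod k.natAbs) : ZMod N →+ ZMod k.natAbs) hh hh1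
      (fun x => by rw [hhα, map_stepCocycle]; simp) 1
    have h2 : ((1 : ℕ) : ZMod k.natAbs) = 0 := by simpa [ZMod.cast_one hdvd] using h1
    rw [Int.isUnit_iff_natAbs_eq]
    exact Nat.dvd_one.1 ((ZMod.natCast_eq_zero_iff _ _).1 h2)
  · intro hunit
    by_contra hmin
    obtain ⟨H, hH, h, hh, hh1, hhα⟩ := exists_coboundary_of_not_minimalExt hα IsStep.stepCocycle
      stepCocycle_add_one hf hmin
    obtain ⟨k, hk, hkN, hka⟩ := exists_not_isUnit_dvd_of_ne_top hH
    exact hk (hunit k hkN (hP' H k hka ⟨h, hh, hh1, fun x => (hhα x).trans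
      (congrArg _ (map_stepCocycle (QuotientAddGroup.mk' H) x))⟩))

theorem intCast_natAbs_eq_zero_iff (k a : ℤ) : (a : ZMod k.natAbs) = 0 ↔ k ∣ a := by
  rw [ZMod.intCast_zmod_eq_zero_iff_dvd, Int.natAbs_dvd]

end Minimality

end StepFunctions

/-- Minimality criteria for extensions of a rotation by a three-valued step function:
(a) if `ζ₁ = 2α` and `ζ₂ ∉ ℤ + αℤ`, `T_f` is minimal iff `gcd(N, 2a₁, a₂, a₃) = 1`;
(b) if `ζ₂ = 2α` and `ζ₁ ∉ ℤ + αℤ`, `T_f` is minimal iff `gcd(N, a₁ + a₂, 2a₂, a₃) = 1`;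
(c) if `ζ₁ = 2α` and `ζ₂ = 3α`, `T_f` is minimal iff `gcd(N, 2a₁ + a₂, a₃) = 1`. -/
theorem threeval_minimal_iff
    (α : ℝ) (hα : α ∈ Ioo (0:ℝ) 1) (hirr : Irrational α) (N : ℕ) (hN : 2 ≤ N)
    (ζ₁ ζ₂ : ℝ) (hζ : 0 < ζ₁ ∧ ζ₁ < ζ₂ ∧ ζ₂ < 1) (a₁ a₂ a₃ : ℤ) :
    (ζ₁ = 2 * α → (¬ ∃ m n : ℤ, ζ₂ = m * α + n) →
      (MinimalExt (rot α) (threeval N ζ₁ ζ₂ a₁ a₂ a₃) ↔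
        ∀ k : ℤ, k ∣ (N : ℤ) → k ∣ 2 * a₁ → k ∣ a₂ → k ∣ a₃ → IsUnit k)) ∧
    (ζ₂ = 2 * α → (¬ ∃ m n : ℤ, ζ₁ = m * α + n) →
      (MinimalExt (rot α) (threeval N ζ₁ ζ₂ a₁ a₂ a₃) ↔
        ∀ k : ℤ, k ∣ (N : ℤ) → k ∣ a₁ + a₂ → k ∣ 2 * a₂ → k ∣ a₃ → IsUnit k)) ∧
    (ζ₁ = 2 * α → ζ₂ = 3 * α →
      (MinimalExt (rot α) (threeval N ζ₁ ζ₂ a₁ a₂ a₃) ↔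
        ∀ k : ℤ, k ∣ (N : ℤ) → k ∣ 2 * a₁ + a₂ → k ∣ a₃ → IsUnit k)) := by
  have : NeZero N := ⟨by lia⟩
  have hZ : ∀ k a : ℤ, k ∣ a ↔ (a : ZMod k.natAbs) = 0 := fun k a =>
    (intCast_natAbs_eq_zero_iff k a).symm
  refine ⟨?_, ?_, ?_⟩
  · rintro rfl hζ₂
    refine (minimalExt_iff_of_isStepCoboundary_iff hirr hζ a₁ a₂ a₃
      (P := fun k => k ∣ 2 * a₁ ∧ k ∣ a₂ ∧ k ∣ a₃) ?_ ?_).trans (by simp only [and_imp])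
    · intro k _ hk
      rw [isStepCoboundary_left_iff hirr hζ₂]
      simpa [hZ] using hk
    · intro H k hk h
      rw [isStepCoboundary_left_iff hirr hζ₂] at h
      refine ⟨hk _ ?_, hk _ h.2.1, hk _ h.2.2⟩
      rw [← h.1, two_mul, Int.cast_add, QuotientAddGroup.mk_add, two_nsmul]
  · rintro rfl hζ₁
    refine (minimalExt_iff_of_isStepCoboundary_iff hirr hζ a₁ a₂ a₃
      (P := fun k => k ∣ a₁ + a₂ ∧ k ∣ 2 * a₂ ∧ k ∣ a₃) ?_ ?_).trans (by simp only [and_imp])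
    · intro k _ hk
      rw [isStepCoboundary_right_iff hirr hζ₁]
      simpa [hZ] using hk
    · intro H k hk h
      rw [isStepCoboundary_right_iff hirr hζ₁] at h
      refine ⟨hk _ ?_, hk _ ?_, hk _ h.2.2⟩
      · rw [← h.1, Int.cast_add, QuotientAddGroup.mk_add]
      · rw [← h.2.1, two_mul, Int.cast_add, QuotientAddGroup.mk_add, two_nsmul]
  · rintro rfl rfl
    refine (minimalExt_iff_of_isStepCoboundary_iff hirr hζ a₁ a₂ a₃
      (P := fun k => k ∣ 2 * a₁ + a₂ ∧ k ∣ a₃) ?_ ?_).trans (by simp only [and_imp])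
    · intro k _ hk
      rw [isStepCoboundary_two_three_iff hirr]
      simpa [hZ] using hk
    · intro H k hk h
      rw [isStepCoboundary_two_three_iff hirr] at h
      refine ⟨hk _ ?_, hk _ h.2⟩
      rw [← h.1, two_mul, Int.cast_add, Int.cast_add, QuotientAddGroup.mk_add,
        QuotientAddGroup.mk_add, two_nsmul]
end
end
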